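/- arXiv:2311.18432 — 3 statements merged into one kernel-verified Lean document; each statement's English description precedes it below -/
import Mathlib

section
/- Let p be an odd prime, s a positive integer, and s1, s2 divisors of s with s2 | s1. For a, b ∈ F_{p^s} with (a,b) ≠ (0,0), c ∈ F_{p^{s2}}, and Γ(s1) = Tr_{F_{p^s}/F_{p^{s1}}}(a^2 + b^2), the number N(a,b) of pairs (x,y) ∈ F_{p^s}^2 satisfying Tr_{F_{p^s}/F_{p^{s1}}}(x^2+y^2) = 0 and Tr_{F_{p^s}/F_{p^{s2}}}(ax+by) + c = 0 equals: p^{2s-s1-s2} + p^{-s1}(p^{s1}-1)G^2 if Γ(s1)=0 and c=0; p^{2s-s1-s2} if Γ(s1)=0 and c≠0; p^{-(s1+s2)}(p^{2s} + (p^{s1}-p^{s2})G^2) if Γ(s1)≠0 and c=0; and p^{2s-s1-s2} + p^{-s2}G^2 if Γ(s1)≠0 and c≠0, where G^2 = (-1)^{((p-1)/2)s} p^s. -/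
open scoped BigOperators

open Finset in
/-- The square of a quadratic exponential sum over a finite field of odd characteristic. -/
theorem sq_sum_addChar_mul_sq {K : Type*} [Field K] [Fintype K] [DecidableEq K]
    (hK : ringChar K ≠ 2) {ψ : AddChar K ℂ} (hψ : ψ.IsPrimitive) {u : K} (hu : u ≠ 0) :
    (∑ x : K, ψ (u * x ^ 2)) ^ 2 = (quadraticChar K (-1) : ℂ) * Fintype.card K := by
  have hprim : (ψ.mulShift u).IsPrimitive := AddChar.IsPrimitive.of_ne_one (hψ hu)
  have hinj : Function.Injective (Int.castRingHom ℂ) := (Int.castRingHom ℂ).injective_int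
  have hne : (quadraticChar K).ringHomComp (Int.castRingHom ℂ) ≠ 1 :=
    (MulChar.ringHomComp_ne_one_iff hinj).mpr (quadraticChar_ne_one hK)
  have hquad := (quadraticChar_isQuadratic K).comp (Int.castRingHom ℂ)
  have hsum : ∑ x : K, ψ (u * x ^ 2)
      = gaussSum ((quadraticChar K).ringHomComp (Int.castRingHom ℂ)) (ψ.mulShift u) := by
    have hfib : ∑ x : K, ψ (u * x ^ 2)
        = ∑ t : K, ((quadraticChar K t : ℂ) + 1) * ψ (u * t) := by
      rw [← sum_fiberwise univ (fun x : K => x ^ 2)]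
      refine sum_congr rfl fun t _ => ?_
      have hcard := quadraticChar_card_sqrts hK t
      have hset : ({x : K | x ^ 2 = t} : Set K).toFinset = ({x | x ^ 2 = t} : Finset K) := by
        ext; simp
      rw [hset] at hcard
      rw [sum_congr rfl (g := fun _ => ψ (u * t)) (fun x hx => by rw [(mem_filter.mp hx).2]),
        sum_const, nsmul_eq_mul]
      congr 1
      exact_mod_cast hcard
    have hzero : ∑ t : K, ψ (u * t) = 0 := by
      have h := AddChar.sum_mulShift u hψ
      simpa [mul_comm, hu] using h
    rw [hfib]
    simp only [add_mul, one_mul, sum_add_distrib, hzero, add_zero, gaussSum]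
    rfl
  rw [hsum, gaussSum_sq hne hquad hprim]
  rfl

theorem sum_addChar_quadratic {K : Type*} [Field K] [Fintype K] (hK : ringChar K ≠ 2)
    (ψ : AddChar K ℂ) {u : K} (hu : u ≠ 0) (w : K) :
    ∑ x : K, ψ (u * x ^ 2 + w * x) = ψ (-(w ^ 2 / (4 * u))) * ∑ x : K, ψ (u * x ^ 2) := by
  have h2 : (2 : K) ≠ 0 := Ring.two_ne_zero hK
  have h4 : (4 : K) ≠ 0 := by
    have : (4 : K) = 2 * 2 := by norm_num
    simp [this, h2]
  rw [Finset.mul_sum, ← Equiv.sum_comp (Equiv.addRight (w / (2 * u)))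
    (fun x => ψ (-(w ^ 2 / (4 * u))) * ψ (u * x ^ 2))]
  refine Finset.sum_congr rfl fun x _ => ?_
  rw [← AddChar.map_add_eq_mul, Equiv.coe_addRight]
  congr 1
  field_simp
  ring

theorem sum_prod_addChar_quadratic {K : Type*} [Field K] [Fintype K] [DecidableEq K]
    (hK : ringChar K ≠ 2) {ψ : AddChar K ℂ} (hψ : ψ.IsPrimitive) {u : K} (hu : u ≠ 0)
    (w a b : K) :
    ∑ xy : K × K, ψ (u * (xy.1 ^ 2 + xy.2 ^ 2) + w * (a * xy.1 + b * xy.2))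
      = (quadraticChar K (-1) : ℂ) * Fintype.card K
        * ψ (-(w ^ 2 / (4 * u) * (a ^ 2 + b ^ 2))) := by
  have hsplit : ∑ xy : K × K, ψ (u * (xy.1 ^ 2 + xy.2 ^ 2) + w * (a * xy.1 + b * xy.2))
      = (∑ x : K, ψ (u * x ^ 2 + w * a * x)) * ∑ y : K, ψ (u * y ^ 2 + w * b * y) := by
    rw [Fintype.sum_prod_type, Finset.sum_mul_sum]
    refine Finset.sum_congr rfl fun x _ => Finset.sum_congr rfl fun y _ => ?_
    rw [← AddChar.map_add_eq_mul]
    congr 1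
    ring
  have hphase : ψ (-(w ^ 2 / (4 * u) * (a ^ 2 + b ^ 2)))
      = ψ (-((w * a) ^ 2 / (4 * u))) * ψ (-((w * b) ^ 2 / (4 * u))) := by
    rw [← AddChar.map_add_eq_mul]
    congr 1
    ring
  rw [hsplit, sum_addChar_quadratic hK ψ hu, sum_addChar_quadratic hK ψ hu, hphase,
    ← sq_sum_addChar_mul_sq hK hψ hu]
  ring

theorem sum_prod_addChar_linear {K : Type*} [Field K] [Fintype K] [DecidableEq K]
    {ψ : AddChar K ℂ} (hψ : ψ.IsPrimitive) {a b : K} (hab : ¬(a = 0 ∧ b = 0)) (w : K) :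
    ∑ xy : K × K, ψ (w * (a * xy.1 + b * xy.2))
      = if w = 0 then (Fintype.card K : ℂ) ^ 2 else 0 := by
  have hsplit : ∑ xy : K × K, ψ (w * (a * xy.1 + b * xy.2))
      = (∑ x : K, ψ (x * (w * a))) * ∑ y : K, ψ (y * (w * b)) := by
    rw [Fintype.sum_prod_type, Finset.sum_mul_sum]
    refine Finset.sum_congr rfl fun x _ => Finset.sum_congr rfl fun y _ => ?_
    rw [← AddChar.map_add_eq_mul]
    congr 1
    ring
  rw [hsplit, AddChar.sum_mulShift _ hψ, AddChar.sum_mulShift _ hψ]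
  by_cases hw : w = 0
  · simp [hw, sq]
  · by_cases ha : a = 0
    · have hb : b ≠ 0 := fun hb => hab ⟨ha, hb⟩
      simp [hw, hb]
    · simp [hw, ha]

theorem sum_erase_zero_addChar_inv_mul {F : Type*} [Field F] [Fintype F] [DecidableEq F]
    {ψ : AddChar F ℂ} (hψ : ψ.IsPrimitive) (t : F) :
    ∑ u ∈ Finset.univ.erase (0 : F), ψ (u⁻¹ * t)
      = if t = 0 then (Fintype.card F : ℂ) - 1 else -1 := by
  have hinv : ∑ u : F, ψ (u⁻¹ * t) = ∑ u : F, ψ (u * t) :=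
    Equiv.sum_comp (Equiv.inv F) (fun u => ψ (u * t))
  have hsum := AddChar.sum_mulShift t hψ
  rw [← hinv, ← Finset.add_sum_erase _ _ (Finset.mem_univ (0 : F))] at hsum
  rw [inv_zero, zero_mul, AddChar.map_zero_eq_one] at hsum
  rw [eq_sub_of_add_eq' hsum]
  split_ifs <;> simp

theorem mem_range_algebraMap_of_pow_card_eq {F K : Type*} [Field F] [Field K] [Fintype F]
    [Algebra F K] {x : K} (hx : x ^ Fintype.card F = x) : ∃ w : F, algebraMap F K w = x := by
  classical
  by_contra hmem
  have hne : (Polynomial.X ^ Fintype.card F - Polynomial.X : Polynomial K) ≠ 0 :=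
    FiniteField.X_pow_card_sub_X_ne_zero K Fintype.one_lt_card
  have hsub : insert x (Finset.univ.image (algebraMap F K))
      ⊆ (Polynomial.X ^ Fintype.card F - Polynomial.X : Polynomial K).roots.toFinset := by
    intro y hy
    rw [Multiset.mem_toFinset, Polynomial.mem_roots hne]
    rcases Finset.mem_insert.mp hy with rfl | hy
    · simp [hx]
    · obtain ⟨w, -, rfl⟩ := Finset.mem_image.mp hy
      simp [← map_pow, FiniteField.pow_card]
  have hcard := (Finset.card_le_card hsub).trans
    ((Multiset.toFinset_card_le _).trans (Polynomial.card_roots' _))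
  rw [FiniteField.X_pow_card_sub_X_natDegree_eq K Fintype.one_lt_card,
    Finset.card_insert_of_notMem (by simpa using hmem),
    Finset.card_image_of_injective _ (algebraMap F K).injective, Finset.card_univ] at hcard
  omega

/-- The canonical additive character of a finite field of characteristic `p`. -/
noncomputable def canonicalAddChar (p : ℕ) [Fact p.Prime] (F : Type*) [Field F]
    [Algebra (ZMod p) F] : AddChar F ℂ :=
  (ZMod.stdAddChar (N := p)).compAddMonoidHom (Algebra.trace (ZMod p) F).toAddMonoidHom

theorem canonicalAddChar_isPrimitive (p : ℕ) [Fact p.Prime] (F : Type*) [Field F] [Finite F]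
    [Algebra (ZMod p) F] : (canonicalAddChar p F).IsPrimitive := by
  refine AddChar.IsPrimitive.of_ne_one fun h => ?_
  have : FiniteDimensional (ZMod p) F := Module.Finite.of_finite
  obtain ⟨x, hx⟩ := Algebra.trace_surjective (ZMod p) F 1
  have h1 := DFunLike.congr_fun h x
  have h2 : ZMod.stdAddChar (N := p) 1 = ZMod.stdAddChar (N := p) 0 := by
    rw [← hx, AddChar.map_zero_eq_one]
    exact h1
  exact one_ne_zero (ZMod.injective_stdAddChar h2)

theorem canonicalAddChar_trace (p : ℕ) [Fact p.Prime] (F K : Type*) [Field F] [Field K]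
    [Finite K] [Algebra (ZMod p) F] [Algebra (ZMod p) K] [Algebra F K] (z : K) :
    canonicalAddChar p F (Algebra.trace F K z) = canonicalAddChar p K z := by
  have : IsScalarTower (ZMod p) F K := IsScalarTower.of_algebraMap_eq' (Subsingleton.elim _ _)
  have : Finite F := Finite.of_injective _ (algebraMap F K).injective
  have : FiniteDimensional (ZMod p) F := Module.Finite.of_finite
  have : FiniteDimensional F K := Module.Finite.of_finite
  exact congrArg (ZMod.stdAddChar (N := p)) (Algebra.trace_trace z)

section Count

variable {F₁ F₂ K : Type*} [Field F₁] [Field F₂] [Field K] [Fintype F₁] [Fintype F₂] [Fintype K]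
  [DecidableEq F₁] [DecidableEq F₂] [Algebra F₁ K] [Algebra F₂ K]
  {ψ₁ : AddChar F₁ ℂ} {ψ₂ : AddChar F₂ ℂ} {ψ : AddChar K ℂ}

theorem card_filter_trace_mul_card (h₁ : ψ₁.IsPrimitive) (h₂ : ψ₂.IsPrimitive)
    (ht₁ : ∀ z, ψ₁ (Algebra.trace F₁ K z) = ψ z) (ht₂ : ∀ z, ψ₂ (Algebra.trace F₂ K z) = ψ z)
    (a b : K) (c : F₂) :
    ((Finset.univ.filter (fun xy : K × K =>
      Algebra.trace F₁ K (xy.1 ^ 2 + xy.2 ^ 2) = 0 ∧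
      Algebra.trace F₂ K (a * xy.1 + b * xy.2) + c = 0)).card : ℂ)
        * (Fintype.card F₁ * Fintype.card F₂)
      = ∑ v : F₂, ψ₂ (v * c) * ∑ u : F₁, ∑ xy : K × K,
          ψ (algebraMap F₁ K u * (xy.1 ^ 2 + xy.2 ^ 2)
            + algebraMap F₂ K v * (a * xy.1 + b * xy.2)) := by
  have hpoint : ∀ xy : K × K, (if Algebra.trace F₁ K (xy.1 ^ 2 + xy.2 ^ 2) = 0 ∧
      Algebra.trace F₂ K (a * xy.1 + b * xy.2) + c = 0 then (1 : ℂ) else 0)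
        * (Fintype.card F₁ * Fintype.card F₂)
      = ∑ v : F₂, ∑ u : F₁, ψ₂ (v * c) * ψ (algebraMap F₁ K u * (xy.1 ^ 2 + xy.2 ^ 2)
            + algebraMap F₂ K v * (a * xy.1 + b * xy.2)) := by
    intro xy
    have hu := AddChar.sum_mulShift (Algebra.trace F₁ K (xy.1 ^ 2 + xy.2 ^ 2)) h₁
    have hv := AddChar.sum_mulShift (Algebra.trace F₂ K (a * xy.1 + b * xy.2) + c) h₂
    trans (∑ v : F₂, ψ₂ (v * (Algebra.trace F₂ K (a * xy.1 + b * xy.2) + c)))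
        * ∑ u : F₁, ψ₁ (u * Algebra.trace F₁ K (xy.1 ^ 2 + xy.2 ^ 2))
    · rw [hu, hv]
      split_ifs <;> simp_all [mul_comm]
    · rw [Finset.sum_mul_sum]
      refine Finset.sum_congr rfl fun v _ => Finset.sum_congr rfl fun u _ => ?_
      rw [AddChar.map_add_eq_mul, ← Algebra.smul_def, ← Algebra.smul_def, ← ht₁, ← ht₂,
        (Algebra.trace F₁ K).map_smul, (Algebra.trace F₂ K).map_smul, smul_eq_mul, smul_eq_mul,
        mul_add, AddChar.map_add_eq_mul]
      ring
  rw [Finset.card_filter, Nat.cast_sum, Finset.sum_mul]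
  simp only [Nat.cast_ite, Nat.cast_one, Nat.cast_zero, hpoint]
  rw [Finset.sum_comm]
  refine Finset.sum_congr rfl fun v _ => ?_
  rw [Finset.sum_comm, Finset.mul_sum]
  simp only [Finset.mul_sum]

theorem sum_sum_prod_addChar [DecidableEq K] (hK : ringChar K ≠ 2) (h₁ : ψ₁.IsPrimitive) (hψ : ψ.IsPrimitive)
    (ht₁ : ∀ z, ψ₁ (Algebra.trace F₁ K z) = ψ z) {a b : K} (hab : ¬(a = 0 ∧ b = 0)) (w : F₁) :
    ∑ u : F₁, ∑ xy : K × K, ψ (algebraMap F₁ K u * (xy.1 ^ 2 + xy.2 ^ 2)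
            + algebraMap F₁ K w * (a * xy.1 + b * xy.2))
      = (if w = 0 then (Fintype.card K : ℂ) ^ 2 else 0)
        + (quadraticChar K (-1) : ℂ) * Fintype.card K
          * if w = 0 ∨ Algebra.trace F₁ K (a ^ 2 + b ^ 2) = 0
            then (Fintype.card F₁ : ℂ) - 1 else -1 := by
  have h2 : (2 : F₁) ≠ 0 := fun h => Ring.two_ne_zero hK (by
    rw [← map_ofNat (algebraMap F₁ K) 2, h, map_zero])
  have h4 : (4 : F₁) ≠ 0 := by
    have : (4 : F₁) = 2 * 2 := by norm_num
    simp [this, h2]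
  rw [← Finset.add_sum_erase _ _ (Finset.mem_univ (0 : F₁))]
  congr 1
  · simp only [map_zero, zero_mul, zero_add]
    rw [sum_prod_addChar_linear hψ hab]
    simp
  · have hterm : ∀ u ∈ Finset.univ.erase (0 : F₁), ∑ xy : K × K,
        ψ (algebraMap F₁ K u * (xy.1 ^ 2 + xy.2 ^ 2)
            + algebraMap F₁ K w * (a * xy.1 + b * xy.2))
        = (quadraticChar K (-1) : ℂ) * Fintype.card K
          * ψ₁ (u⁻¹ * (-(w ^ 2 / 4) * Algebra.trace F₁ K (a ^ 2 + b ^ 2))) := by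
      intro u hu
      have hu0 : u ≠ 0 := Finset.ne_of_mem_erase hu
      rw [sum_prod_addChar_quadratic hK hψ (by simpa using hu0), ← mul_assoc u⁻¹,
        ← smul_eq_mul _ (Algebra.trace F₁ K _), ← map_smul, ht₁, Algebra.smul_def]
      congr 2
      simp only [map_mul, map_inv₀, map_neg, map_div₀, map_pow, map_ofNat]
      rw [div_mul_eq_div_div]
      ring
    rw [Finset.sum_congr rfl hterm, ← Finset.mul_sum, sum_erase_zero_addChar_inv_mul h₁]
    congr 1
    simp [h4]

theorem card_filter_trace_eq [DecidableEq K] (hK : ringChar K ≠ 2) (h₁ : ψ₁.IsPrimitive)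
    (h₂ : ψ₂.IsPrimitive) (hψ : ψ.IsPrimitive) (ht₁ : ∀ z, ψ₁ (Algebra.trace F₁ K z) = ψ z)
    (ht₂ : ∀ z, ψ₂ (Algebra.trace F₂ K z) = ψ z)
    (hF : ∀ v : F₂, ∃ w : F₁, algebraMap F₁ K w = algebraMap F₂ K v)
    {a b : K} (hab : ¬(a = 0 ∧ b = 0)) (c : F₂) :
    ((Finset.univ.filter (fun xy : K × K =>
      Algebra.trace F₁ K (xy.1 ^ 2 + xy.2 ^ 2) = 0 ∧
      Algebra.trace F₂ K (a * xy.1 + b * xy.2) + c = 0)).card : ℤ)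
        * (Fintype.card F₁ * Fintype.card F₂)
      = (Fintype.card K : ℤ) ^ 2 + quadraticChar K (-1) * Fintype.card K
        * if Algebra.trace F₁ K (a ^ 2 + b ^ 2) = 0
          then (Fintype.card F₁ - 1) * (if c = 0 then (Fintype.card F₂ : ℤ) else 0)
          else Fintype.card F₁ - if c = 0 then (Fintype.card F₂ : ℤ) else 0 := by
  have key := card_filter_trace_mul_card h₁ h₂ ht₁ ht₂ a b c
  set Γ := Algebra.trace F₁ K (a ^ 2 + b ^ 2) with hΓ
  set A : ℂ := (quadraticChar K (-1) : ℂ) * Fintype.card K with hA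
  have hinner : ∀ v : F₂, ∑ u : F₁, ∑ xy : K × K, ψ (algebraMap F₁ K u * (xy.1 ^ 2 + xy.2 ^ 2)
            + algebraMap F₂ K v * (a * xy.1 + b * xy.2))
      = (if v = 0 then (Fintype.card K : ℂ) ^ 2 else 0)
        + A * if v = 0 ∨ Γ = 0 then (Fintype.card F₁ : ℂ) - 1 else -1 := by
    intro v
    obtain ⟨w, hw⟩ := hF v
    have hwv : w = 0 ↔ v = 0 := by
      rw [← map_eq_zero (algebraMap F₁ K), hw, map_eq_zero]
    rw [← hw, sum_sum_prod_addChar hK h₁ hψ ht₁ hab w]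
    simp only [hwv, hA, hΓ]
  have hsplit : ∀ v : F₂, ψ₂ (v * c) * ((if v = 0 then (Fintype.card K : ℂ) ^ 2 else 0)
        + A * if v = 0 ∨ Γ = 0 then (Fintype.card F₁ : ℂ) - 1 else -1)
      = (if v = 0 then (Fintype.card K : ℂ) ^ 2
          + A * (if Γ = 0 then 0 else (Fintype.card F₁ : ℂ)) else 0)
        + A * (if Γ = 0 then (Fintype.card F₁ : ℂ) - 1 else -1) * ψ₂ (v * c) := by
    intro v
    by_cases hv : v = 0
    · subst hv
      by_cases hg : Γ = 0
      · simp [hg]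
      · simp [hg]; ring
    · by_cases hg : Γ = 0
      · simp [hg, hv]; ring
      · simp [hg, hv]; ring
  simp only [hinner, hsplit] at key
  rw [Finset.sum_add_distrib, Finset.sum_ite_eq' Finset.univ (0 : F₂), ← Finset.mul_sum,
    AddChar.sum_mulShift c h₂, if_pos (Finset.mem_univ _)] at key
  rw [← Int.cast_inj (α := ℂ)]
  push_cast
  rw [key, hA]
  split_ifs <;> push_cast <;> ring

end Count

theorem quadraticChar_neg_one_of_card_eq_pow {K : Type*} [Field K] [Fintype K] [DecidableEq K]
    (hK : ringChar K ≠ 2) {p s : ℕ} (hodd : Odd p) (hcard : Fintype.card K = p ^ s) :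
    quadraticChar K (-1) = (-1) ^ ((p - 1) / 2 * s) := by
  have hdiv : (p - 1) / 2 = p / 2 := by
    obtain ⟨k, rfl⟩ := hodd
    omega
  rw [quadraticChar_neg_one hK, hcard, Nat.cast_pow, map_pow,
    ZMod.χ₄_eq_neg_one_pow (Nat.odd_iff.mp hodd), ← pow_mul, hdiv]

/-- the value of
`N(a,b) = #{(x,y) ∈ F_{p^s}² : Tr_{s1}(x²+y²)=0, Tr_{s2}(ax+by)+c=0}` for `(a,b) ≠ (0,0)`
and `s2 ∣ s1 ∣ s`, where `G² = (-1)^(((p-1)/2)s) p^s`.  (Stated multiplied through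
by `p^(s1+s2)`.) -/
theorem stmt5 (p s s1 s2 : ℕ) (hp : p.Prime) (hodd : Odd p) (hs : 0 < s)
    (hs2 : 0 < s2) (hdvd1 : s1 ∣ s) (hdvd2 : s2 ∣ s1)
    (F1 F2 K : Type) [Field F1] [Field F2] [Field K]
    [Fintype F1] [Fintype F2] [Fintype K]
    [DecidableEq F1] [DecidableEq F2] [DecidableEq K]
    [Algebra F1 K] [Algebra F2 K]
    (hcard1 : Fintype.card F1 = p ^ s1) (hcard2 : Fintype.card F2 = p ^ s2)
    (hcard : Fintype.card K = p ^ s)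
    (a b : K) (hab : ¬(a = 0 ∧ b = 0)) (c : F2) :
    let G2 : ℤ := (-1) ^ (((p - 1) / 2) * s) * p ^ s
    let N : ℕ := (Finset.univ.filter (fun xy : K × K =>
      Algebra.trace F1 K (xy.1 ^ 2 + xy.2 ^ 2) = 0 ∧
      Algebra.trace F2 K (a * xy.1 + b * xy.2) + c = 0)).card
    (Algebra.trace F1 K (a ^ 2 + b ^ 2) = 0 → c = 0 →
      (N : ℤ) * p ^ (s1 + s2) = p ^ (2 * s) + (p ^ s1 - 1) * G2 * p ^ s2) ∧
    (Algebra.trace F1 K (a ^ 2 + b ^ 2) = 0 → c ≠ 0 →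
      (N : ℤ) * p ^ (s1 + s2) = p ^ (2 * s)) ∧
    (Algebra.trace F1 K (a ^ 2 + b ^ 2) ≠ 0 → c = 0 →
      (N : ℤ) * p ^ (s1 + s2) = p ^ (2 * s) + (p ^ s1 - p ^ s2) * G2) ∧
    (Algebra.trace F1 K (a ^ 2 + b ^ 2) ≠ 0 → c ≠ 0 →
      (N : ℤ) * p ^ (s1 + s2) = p ^ (2 * s) + G2 * p ^ s1) := by
  intro G2 N
  have : Fact p.Prime := ⟨hp⟩
  have hchar : ∀ (L : Type) [Field L] [Fintype L] (n : ℕ), Fintype.card L = p ^ n → CharP L p :=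
    fun L _ _ n h => charP_of_card_eq_prime_pow h
  have := hchar F1 s1 hcard1
  have := hchar F2 s2 hcard2
  have := hchar K s hcard
  let := ZMod.algebra F1 p
  let := ZMod.algebra F2 p
  let := ZMod.algebra K p
  have hK : ringChar K ≠ 2 := by
    rw [ringChar.eq K p]
    rintro rfl
    exact absurd hodd (by decide)
  have hF : ∀ v : F2, ∃ w : F1, algebraMap F1 K w = algebraMap F2 K v := by
    intro v
    refine mem_range_algebraMap_of_pow_card_eq ?_
    obtain ⟨k, rfl⟩ := hdvd2
    rw [← map_pow, hcard1, pow_mul, ← hcard2, FiniteField.pow_card_pow]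
  have key := card_filter_trace_eq hK (canonicalAddChar_isPrimitive p F1)
    (canonicalAddChar_isPrimitive p F2) (canonicalAddChar_isPrimitive p K)
    (canonicalAddChar_trace p F1 K) (canonicalAddChar_trace p F2 K) hF hab c
  rw [hcard1, hcard2, hcard, quadraticChar_neg_one_of_card_eq_pow hK hodd hcard] at key
  push_cast at key
  change (N : ℤ) * _ = _ + G2 * _ at key
  rw [← pow_add, ← pow_mul, mul_comm s 2] at key
  refine ⟨fun hg hc => ?_, fun hg hc => ?_, fun hg hc => ?_, fun hg hc => ?_⟩ <;>
    rw [key] <;> simp only [hg, hc, if_true, if_false] <;> ring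
end

section
/- Let p be an odd prime, s a positive integer, and s1, s2 divisors of s with s2 | s1 and s ≥ 2s1. Then the code C_D over F_{p^{s2}} with codewords (Tr_{F_{p^s}/F_{p^{s2}}}(ax+by) + c)_{(x,y)∈D}, where D = {(x,y) ∈ F_{p^s}^2 : Tr_{F_{p^s}/F_{p^{s1}}}(x^2+y^2)=0}, is self-orthogonal: every pair of codewords has zero standard inner product over F_{p^{s2}}. -/
open scoped BigOperators

namespace MvPolynomial

variable {k ι V : Type*} [Field k] [Fintype ι] [AddCommGroup V] [Module k V]

/-- A linear functional is a polynomial of degree at most one in the coordinates. -/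
theorem exists_eval_repr_eq_linearMap (e : Module.Basis ι k V) (f : V →ₗ[k] k) :
    ∃ P : MvPolynomial ι k, P.totalDegree ≤ 1 ∧ ∀ v, eval (e.repr v) P = f v := by
  refine ⟨∑ i, C (f (e i)) * X i, totalDegree_finsetSum_le fun i _ => ?_, fun v => ?_⟩
  · refine (totalDegree_mul _ _).trans ?_
    simp
  · conv_rhs => rw [← e.sum_repr v]
    simp only [map_sum, map_mul, eval_C, eval_X, map_smul, smul_eq_mul]
    exact Finset.sum_congr rfl fun i _ => mul_comm _ _

/-- The diagonal of a bilinear form is a polynomial of degree at most two in the coordinates. -/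
theorem exists_eval_repr_eq_bilinForm (e : Module.Basis ι k V) (B : V →ₗ[k] V →ₗ[k] k) :
    ∃ P : MvPolynomial ι k, P.totalDegree ≤ 2 ∧ ∀ v, eval (e.repr v) P = B v v := by
  refine ⟨∑ i, ∑ j, C (B (e i) (e j)) * (X i * X j), totalDegree_finsetSum_le fun i _ =>
    totalDegree_finsetSum_le fun j _ => ?_, fun v => ?_⟩
  · refine (totalDegree_mul _ _).trans ?_
    have := totalDegree_mul (X i : MvPolynomial ι k) (X j)
    simp only [totalDegree_X, totalDegree_C] at *
    omega
  · conv_rhs => rw [← e.sum_repr v]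
    simp only [map_sum, map_mul, eval_C, eval_X, map_smul, LinearMap.sum_apply,
      LinearMap.smul_apply, smul_eq_mul, Finset.mul_sum]
    rw [Finset.sum_comm]
    exact Finset.sum_congr rfl fun i _ => Finset.sum_congr rfl fun j _ => by ring

end MvPolynomial

section ChevalleyWarning

open Module

variable {k V W A : Type*} [Field k] [Fintype k] [AddCommGroup V] [Module k V] [Fintype V]
  [AddCommGroup W] [Module k W] [FiniteDimensional k W] [DecidableEq W]

/-- A product of two affine functionals sums to zero over the zero set of a vector-valued
quadratic map with few components. -/
theorem sum_affine_mul_affine_quadric_eq_zero (B : V →ₗ[k] V →ₗ[k] W) (f g : V →ₗ[k] k)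
    (c d : k) (h : 2 * (Fintype.card k - 1) * finrank k W + 2
      < (Fintype.card k - 1) * finrank k V) :
    ∑ v with B v v = 0, (f v + c) * (g v + d) = 0 := by
  classical
  have : Module.Finite k V := Module.Finite.of_finite
  let e := finBasis k V
  let w := finBasis k W
  obtain ⟨P, hP, hPe⟩ := MvPolynomial.exists_eval_repr_eq_linearMap e f
  obtain ⟨P', hP', hPe'⟩ := MvPolynomial.exists_eval_repr_eq_linearMap e g
  choose Q hQ hQe using fun i =>
    MvPolynomial.exists_eval_repr_eq_bilinForm e (B.compr₂ (w.coord i))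
  let R : MvPolynomial (Fin (finrank k V)) k :=
    (∏ i, (1 - Q i ^ (Fintype.card k - 1))) *
      ((P + MvPolynomial.C c) * (P' + MvPolynomial.C d))
  have hR : R.totalDegree < (Fintype.card k - 1) * Fintype.card (Fin (finrank k V)) := by
    rw [Fintype.card_fin]
    refine lt_of_le_of_lt ?_ h
    refine (MvPolynomial.totalDegree_mul _ _).trans (add_le_add ?_ ?_)
    · refine (MvPolynomial.totalDegree_finsetProd _ _).trans ?_
      refine (Finset.sum_le_card_nsmul _ _ (2 * (Fintype.card k - 1)) fun i _ => ?_).trans ?_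
      · refine (MvPolynomial.totalDegree_sub _ _).trans (max_le (by simp) ?_)
        refine (MvPolynomial.totalDegree_pow _ _).trans ?_
        rw [mul_comm]
        exact Nat.mul_le_mul_right _ (hQ i)
      · simp [mul_comm]
    · refine (MvPolynomial.totalDegree_mul _ _).trans (add_le_add (b := 1) (d := 1) ?_ ?_) <;>
        exact (MvPolynomial.totalDegree_add _ _).trans (max_le (by assumption) (by simp))
  rw [← MvPolynomial.sum_eval_eq_zero R hR, Finset.sum_filter,
    ← Equiv.sum_comp e.equivFun.toEquiv]
  refine Finset.sum_congr rfl fun v _ => ?_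
  have hv : e.equivFun.toEquiv v = e.repr v := rfl
  simp only [R, hv, map_mul, map_prod, map_sub, map_one, map_pow, map_add, MvPolynomial.eval_C,
    hPe, hPe', hQe, LinearMap.compr₂_apply]
  split_ifs with h0
  · have : Fintype.card k - 1 ≠ 0 := Nat.sub_ne_zero_of_lt Fintype.one_lt_card
    simp [h0, this]
  · obtain ⟨i, hi⟩ : ∃ i, w.coord i (B v v) ≠ 0 := by
      by_contra! hall
      exact h0 (w.forall_coord_eq_zero_iff.mp hall)
    rw [Finset.prod_eq_zero (Finset.mem_univ i), zero_mul]
    rw [FiniteField.pow_card_sub_one_eq_one _ hi, sub_self]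

/-- The version of `sum_affine_mul_affine_quadric_eq_zero` for affine maps with values in a
finite-dimensional algebra. -/
theorem sum_affine_mul_affine_quadric_eq_zero_of_algebra [Ring A] [Algebra k A]
    [FiniteDimensional k A] (B : V →ₗ[k] V →ₗ[k] W) (f g : V →ₗ[k] A)
    (c d : A) (h : 2 * (Fintype.card k - 1) * finrank k W + 2
      < (Fintype.card k - 1) * finrank k V) :
    ∑ v with B v v = 0, (f v + c) * (g v + d) = 0 := by
  let a := finBasis k A
  have key (v : V) : (f v + c) * (g v + d) = ∑ i, ∑ j,
      (((a.coord i ∘ₗ f) v + a.coord i c) * ((a.coord j ∘ₗ g) v + a.coord j d)) •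
        (a i * a j) := by
    conv_lhs => rw [← a.sum_repr (f v + c), ← a.sum_repr (g v + d)]
    simp only [Finset.sum_mul_sum, smul_mul_smul_comm, map_add, Finsupp.add_apply,
      LinearMap.comp_apply, Module.Basis.coord_apply]
  simp_rw [key]
  rw [Finset.sum_comm]
  refine Finset.sum_eq_zero fun i _ => ?_
  rw [Finset.sum_comm]
  refine Finset.sum_eq_zero fun j _ => ?_
  rw [← Finset.sum_smul, sum_affine_mul_affine_quadric_eq_zero B _ _ _ _ h, zero_smul]

end ChevalleyWarning

/-- with `s2 ∣ s1 ∣ s` and `s ≥ 2·s1`, the code `C_D` is self-orthogonal: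
any two codewords `(Tr_{K/F2}(ax+by)+c)_{(x,y)∈D}` and `(Tr_{K/F2}(a'x+b'y)+c')_{(x,y)∈D}`
have zero standard inner product over `F_{p^{s2}}`. -/
theorem stmt8 (p s s1 s2 : ℕ) (hp : p.Prime) (hodd : Odd p) (hs : 0 < s)
    (hs2 : 0 < s2) (hdvd1 : s1 ∣ s) (hdvd2 : s2 ∣ s1) (hbig : 2 * s1 ≤ s)
    (F1 F2 K : Type) [Field F1] [Field F2] [Field K]
    [Fintype F1] [Fintype F2] [Fintype K]
    [DecidableEq F1] [DecidableEq F2] [DecidableEq K]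
    [Algebra F1 K] [Algebra F2 K]
    (hcard1 : Fintype.card F1 = p ^ s1) (hcard2 : Fintype.card F2 = p ^ s2)
    (hcard : Fintype.card K = p ^ s)
    (a b a' b' : K) (c c' : F2) :
    ∑ xy ∈ Finset.univ.filter
        (fun xy : K × K => Algebra.trace F1 K (xy.1 ^ 2 + xy.2 ^ 2) = 0),
      (Algebra.trace F2 K (a * xy.1 + b * xy.2) + c) *
        (Algebra.trace F2 K (a' * xy.1 + b' * xy.2) + c') = 0 := by
  have := Fact.mk hp
  have hs1 : 0 < s1 := Nat.pos_of_dvd_of_pos hdvd1 hs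
  have hp3 : 2 < p := lt_of_le_of_ne hp.two_le (by rintro rfl; exact absurd hodd (by decide))
  have charP_of_card {F : Type} [Field F] [Fintype F] {n : ℕ}
      (hF : Fintype.card F = p ^ n) : CharP F p := charP_of_card_eq_prime_pow hF
  have := charP_of_card hcard1
  have := charP_of_card hcard2
  have := charP_of_card hcard
  let := ZMod.algebra F1 p
  let := ZMod.algebra F2 p
  let := ZMod.algebra K p
  have finrank_of_card {F : Type} [Field F] [Fintype F] [Algebra (ZMod p) F] {n : ℕ}
      (hF : Fintype.card F = p ^ n) : Module.finrank (ZMod p) F = n := by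
    have := Module.card_eq_pow_finrank (K := ZMod p) (V := F)
    rw [hF, ZMod.card] at this
    exact (Nat.pow_right_injective hp.two_le this).symm
  let t1 : K →ₗ[ZMod p] F1 := (Algebra.trace F1 K).toAddMonoidHom.toZModLinearMap p
  let t2 : K →ₗ[ZMod p] F2 := (Algebra.trace F2 K).toAddMonoidHom.toZModLinearMap p
  let x : K × K →ₗ[ZMod p] K := LinearMap.fst _ _ _
  let y : K × K →ₗ[ZMod p] K := LinearMap.snd _ _ _
  let m := LinearMap.mul (ZMod p) K
  let B := (m.compl₁₂ x x + m.compl₁₂ y y).compr₂ t1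
  let f (a b : K) := t2 ∘ₗ (m a ∘ₗ x + m b ∘ₗ y)
  have hB (v : K × K) : B v v = Algebra.trace F1 K (v.1 ^ 2 + v.2 ^ 2) := by
    rw [sq, sq]
    rfl
  simp_rw [← hB]
  refine sum_affine_mul_affine_quadric_eq_zero_of_algebra B (f a b) (f a' b') c c' ?_
  rw [Module.finrank_prod, finrank_of_card hcard, finrank_of_card hcard1, ZMod.card]
  obtain ⟨r, rfl⟩ : ∃ r, p = r + 3 := ⟨p - 3, by omega⟩
  rw [show r + 3 - 1 = r + 2 by omega]
  nlinarith [Nat.mul_le_mul_left (r + 2) hbig, Nat.mul_le_mul_left (r + 2) hs1]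
end

section
/- Let p be an odd prime, s = 2, s1 = s2 = 1, and let C_D be the code over F_p with codewords (Tr_{F_{p^2}/F_p}(ax+by)+c)_{(x,y)∈D} where D = {(x,y) ∈ F_{p^2}^2 : Tr_{F_{p^2}/F_p}(x^2+y^2)=0}. Then C_D is a [p^3+p^2-p, 5] code over F_p and its minimum Hamming distance equals p^2(p-1). -/
open scoped BigOperators

attribute [local instance] ZMod.algebra

lemma card_filter_prod {K : Type*} [Fintype K] (P : K → K → Prop) [∀ u v, Decidable (P u v)] :
    (Finset.univ.filter fun z : K × K => P z.1 z.2).card =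
      ∑ u : K, (Finset.univ.filter fun v : K => P u v).card := by
  simp only [Finset.card_filter]
  exact Fintype.sum_prod_type _

section Line

variable {p : ℕ} [Fact p.Prime] {K : Type*} [Field K] [DecidableEq K] [CharP K p]

variable (p) in
/-- The line `F_p · b` in `K`. -/
def line (b : K) : Finset K :=
  Finset.univ.image fun t : ZMod p => t • b

lemma card_line {b : K} (hb : b ≠ 0) : (line p b).card = p := by
  rw [line, Finset.card_image_of_injective _ (smul_left_injective _ hb), Finset.card_univ,
    ZMod.card]

lemma zero_mem_line (b : K) : (0 : K) ∈ line p b :=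
  Finset.mem_image.2 ⟨0, Finset.mem_univ _, zero_smul _ _⟩

end Line

section TracePairing

variable {p : ℕ} [Fact p.Prime] {K : Type*} [Field K] [Fintype K] [CharP K p]

lemma card_linear_fiber {T : K →ₗ[ZMod p] ZMod p} (hT : Function.Surjective T)
    (hcard : Fintype.card K = p ^ 2) {b : K} (hb : b ≠ 0) (e : ZMod p) :
    (Finset.univ.filter fun v : K => T (b * v) = e).card = p := by
  have hs : Function.Surjective fun v : K => T (b * v) := fun y => by
    obtain ⟨z, hz⟩ := hT y
    exact ⟨b⁻¹ * z, by simp [mul_inv_cancel_left₀ hb, hz]⟩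
  let f : K →+ ZMod p := T.toAddMonoidHom.comp (AddMonoidHom.mulLeft b)
  have hf (e' : ZMod p) : (Finset.univ.filter fun v : K => T (b * v) = e').card =
      (Finset.univ.filter fun v : K => T (b * v) = e).card :=
    AddMonoidHom.card_fiber_eq_of_mem_range f (hs e') (hs e)
  have h := Finset.card_eq_sum_card_fiberwise (s := (Finset.univ : Finset K))
    (t := (Finset.univ : Finset (ZMod p))) (f := fun v : K => T (b * v)) (by simp)
  rw [Finset.sum_congr rfl fun e' _ => hf e', Finset.card_univ, hcard, Finset.sum_const,
    Finset.card_univ, ZMod.card, smul_eq_mul, sq] at h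
  exact (Nat.eq_of_mul_eq_mul_left (Fact.out : p.Prime).pos h).symm

lemma card_compl_fiber {T : K →ₗ[ZMod p] ZMod p} (hT : Function.Surjective T)
    (hcard : Fintype.card K = p ^ 2) {b : K} (hb : b ≠ 0) (e : ZMod p) :
    (Finset.univ.filter fun v : K => e + T (b * v) ≠ 0).card = p ^ 2 - p := by
  have h := Finset.card_filter_add_card_filter_not (s := (Finset.univ : Finset K))
    (fun v : K => T (b * v) = -e)
  rw [card_linear_fiber hT hcard hb, Finset.card_univ, hcard] at h
  have : (Finset.univ.filter fun v : K => e + T (b * v) ≠ 0) =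
      Finset.univ.filter fun v : K => ¬ T (b * v) = -e := by
    ext v
    simp [add_comm e, add_eq_zero_iff_eq_neg]
  rw [this]
  omega

/-- Weight of a codeword in isotropic coordinates. -/
def isotropicWeight (T : K →ₗ[ZMod p] ZMod p) (a b : K) (c : ZMod p) : ℕ :=
  (Finset.univ.filter fun z : K × K =>
    T (z.1 * z.2) = 0 ∧ T (a * z.1 + b * z.2) + c ≠ 0).card

lemma isotropicWeight_eq_sum (T : K →ₗ[ZMod p] ZMod p) (a b : K) (c : ZMod p) :
    isotropicWeight T a b c = ∑ u : K, (Finset.univ.filter fun v : K =>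
      T (u * v) = 0 ∧ T (a * u) + c + T (b * v) ≠ 0).card := by
  rw [isotropicWeight, card_filter_prod fun u v => T (u * v) = 0 ∧ T (a * u + b * v) + c ≠ 0]
  simp only [map_add, add_right_comm]

lemma isotropicWeight_swap (T : K →ₗ[ZMod p] ZMod p) (a b : K) (c : ZMod p) :
    isotropicWeight T a b c = isotropicWeight T b a c := by
  refine Finset.card_equiv (Equiv.prodComm K K) fun z => ?_
  simp only [Finset.mem_filter, Finset.mem_univ, true_and, Equiv.prodComm_apply, Prod.fst_swap,
    Prod.snd_swap, mul_comm z.1, add_comm (a * z.1)]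

variable [DecidableEq K]

lemma bijective_pair {T : K →ₗ[ZMod p] ZMod p} (hT : Function.Surjective T)
    (hcard : Fintype.card K = p ^ 2) {b u : K} (hb : b ≠ 0) (hu : u ∉ line p b) :
    Function.Bijective fun v : K => (T (u * v), T (b * v)) := by
  rw [Fintype.bijective_iff_injective_and_card]
  refine ⟨fun v w hvw => ?_, by rw [hcard, Fintype.card_prod, ZMod.card, sq]⟩
  by_contra hne
  obtain ⟨h1, h2⟩ := Prod.mk.inj hvw
  have hd : v - w ≠ 0 := sub_ne_zero.2 hne
  have hu0 : T ((v - w) * u) = 0 := by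
    rw [mul_comm, mul_sub, map_sub, h1, sub_self]
  have hb0 : T ((v - w) * b) = 0 := by
    rw [mul_comm, mul_sub, map_sub, h2, sub_self]
  have hsub : line p b ⊆ Finset.univ.filter fun z : K => T ((v - w) * z) = 0 := by
    intro z hz
    obtain ⟨t, -, rfl⟩ := Finset.mem_image.1 hz
    simp [hb0]
  have heq := Finset.eq_of_subset_of_card_le hsub
    (by rw [card_linear_fiber hT hcard hd, card_line hb])
  exact hu (heq ▸ Finset.mem_filter.2 ⟨Finset.mem_univ _, hu0⟩)

lemma card_fiber_ne {T : K →ₗ[ZMod p] ZMod p} (hT : Function.Surjective T)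
    (hcard : Fintype.card K = p ^ 2) {b u : K} (hb : b ≠ 0) (hu : u ∉ line p b) (e : ZMod p) :
    (Finset.univ.filter fun v : K => T (u * v) = 0 ∧ e + T (b * v) ≠ 0).card = p - 1 := by
  have hu0 : u ≠ 0 := fun h => hu (h ▸ zero_mem_line b)
  obtain ⟨v₀, hv₀, huniq⟩ := (bijective_pair hT hcard hb hu).existsUnique (0, -e)
  have hset : (Finset.univ.filter fun v : K => T (u * v) = 0 ∧ e + T (b * v) ≠ 0) =
      (Finset.univ.filter fun v : K => T (u * v) = 0).erase v₀ := by
    obtain ⟨h1, h2⟩ := Prod.mk.inj hv₀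
    ext v
    simp only [Finset.mem_filter, Finset.mem_univ, true_and, Finset.mem_erase]
    constructor
    · rintro ⟨hv, hne⟩
      exact ⟨fun h => hne (by rw [h, h2, add_neg_cancel]), hv⟩
    · rintro ⟨hne, hv⟩
      refine ⟨hv, fun h => hne (huniq v ?_)⟩
      simp [hv, eq_neg_of_add_eq_zero_right h]
  rw [hset, Finset.card_erase_of_mem, card_linear_fiber hT hcard hu0]
  simpa using (Prod.mk.inj hv₀).1

lemma card_isotropic {T : K →ₗ[ZMod p] ZMod p} (hT : Function.Surjective T)
    (hcard : Fintype.card K = p ^ 2) :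
    (Finset.univ.filter fun z : K × K => T (z.1 * z.2) = 0).card = p ^ 3 + p ^ 2 - p := by
  rw [card_filter_prod fun u v => T (u * v) = 0,
    ← Finset.add_sum_erase _ _ (Finset.mem_univ (0 : K)),
    Finset.sum_congr rfl fun u hu => card_linear_fiber hT hcard (Finset.ne_of_mem_erase hu) 0]
  simp only [zero_mul, map_zero, Finset.filter_true, Finset.card_univ, hcard, Finset.sum_const,
    Finset.card_erase_of_mem (Finset.mem_univ _), smul_eq_mul, Nat.sub_mul]
  have : p ≤ p ^ 3 := Nat.le_self_pow three_ne_zero p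
  have h3 : p ^ 2 * p = p ^ 3 := by ring
  omega

variable (p) in
/-- Contribution of `u` to the minimal weight. -/
def minContribution (b u : K) : ℕ :=
  if u = 0 then p ^ 2 - p else if u ∈ line p b then 0 else p - 1

lemma sum_minContribution (hcard : Fintype.card K = p ^ 2) {b : K} (hb : b ≠ 0) :
    ∑ u : K, minContribution p b u = p ^ 2 * (p - 1) := by
  rw [← Finset.sum_add_sum_compl (line p b),
    ← Finset.add_sum_erase _ _ (zero_mem_line (p := p) b)]
  have h1 : ∑ u ∈ (line p b).erase 0, minContribution p b u = 0 :=
    Finset.sum_eq_zero fun u hu => by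
      rw [minContribution, if_neg (Finset.ne_of_mem_erase hu), if_pos (Finset.mem_of_mem_erase hu)]
  have h2 : ∑ u ∈ (line p b)ᶜ, minContribution p b u = (p ^ 2 - p) * (p - 1) := by
    rw [Finset.sum_congr rfl (g := fun _ => p - 1), Finset.sum_const, Finset.card_compl, hcard,
      card_line hb, smul_eq_mul]
    intro u hu
    have hu' := Finset.mem_compl.1 hu
    rw [minContribution, if_neg (fun h : u = 0 => hu' (h ▸ zero_mem_line b)),
      if_neg hu']
  rw [h1, h2, minContribution, if_pos rfl]
  obtain ⟨n, hn⟩ := Nat.exists_eq_add_of_le' (Fact.out : p.Prime).pos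
  have : p ^ 2 - p = p * (p - 1) := by rw [Nat.mul_sub, sq, mul_one]
  rw [this]
  rw [Nat.succ_eq_add_one, zero_add] at hn
  rw [hn, Nat.add_sub_cancel]
  ring

lemma minContribution_le {T : K →ₗ[ZMod p] ZMod p} (hT : Function.Surjective T)
    (hcard : Fintype.card K = p ^ 2) {b : K} (hb : b ≠ 0) (u : K) (e : ZMod p) :
    minContribution p b u ≤
      (Finset.univ.filter fun v : K => T (u * v) = 0 ∧ e + T (b * v) ≠ 0).card := by
  unfold minContribution
  split_ifs with h0 h1
  · subst h0
    simpa using (card_compl_fiber hT hcard hb e).ge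
  · exact Nat.zero_le _
  · exact (card_fiber_ne hT hcard hb h1 e).ge

lemma minContribution_eq {T : K →ₗ[ZMod p] ZMod p} (hT : Function.Surjective T)
    (hcard : Fintype.card K = p ^ 2) {b : K} (hb : b ≠ 0) (u : K) :
    (Finset.univ.filter fun v : K => T (u * v) = 0 ∧ 0 + T (b * v) ≠ 0).card =
      minContribution p b u := by
  unfold minContribution
  split_ifs with h0 h1
  · subst h0
    simpa using card_compl_fiber hT hcard hb 0
  · obtain ⟨t, -, rfl⟩ := Finset.mem_image.1 h1
    have ht : t ≠ 0 := fun h => h0 (by simp [h])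
    simp +contextual [ht]
  · exact card_fiber_ne hT hcard hb h1 0

lemma le_isotropicWeight_of_ne_zero {T : K →ₗ[ZMod p] ZMod p} (hT : Function.Surjective T)
    (hcard : Fintype.card K = p ^ 2) (a : K) {b : K} (hb : b ≠ 0) (c : ZMod p) :
    p ^ 2 * (p - 1) ≤ isotropicWeight T a b c := by
  rw [isotropicWeight_eq_sum, ← sum_minContribution hcard hb]
  exact Finset.sum_le_sum fun u _ => minContribution_le hT hcard hb u _

lemma le_isotropicWeight {T : K →ₗ[ZMod p] ZMod p} (hT : Function.Surjective T)
    (hcard : Fintype.card K = p ^ 2) {a b : K} {c : ZMod p}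
    (h : ¬(a = 0 ∧ b = 0 ∧ c = 0)) : p ^ 2 * (p - 1) ≤ isotropicWeight T a b c := by
  by_cases hb : b = 0
  · by_cases ha : a = 0
    · have hc : c ≠ 0 := fun hc => h ⟨ha, hb, hc⟩
      have hw : isotropicWeight T a b c = p ^ 3 + p ^ 2 - p := by
        rw [← card_isotropic hT hcard, isotropicWeight]
        simp [ha, hb, hc]
      have hle : p ≤ p ^ 2 := Nat.le_self_pow two_ne_zero p
      have h3 : p ^ 2 * p = p ^ 3 := by ring
      rw [hw, Nat.mul_sub, mul_one, h3]
      omega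
    · rw [isotropicWeight_swap]
      exact le_isotropicWeight_of_ne_zero hT hcard b ha c
  · exact le_isotropicWeight_of_ne_zero hT hcard a hb c

lemma isotropicWeight_zero_one {T : K →ₗ[ZMod p] ZMod p} (hT : Function.Surjective T)
    (hcard : Fintype.card K = p ^ 2) : isotropicWeight T 0 1 0 = p ^ 2 * (p - 1) := by
  rw [isotropicWeight_eq_sum, ← sum_minContribution hcard one_ne_zero]
  refine Finset.sum_congr rfl fun u _ => ?_
  rw [← minContribution_eq hT hcard one_ne_zero]
  simp

/-- A square root `i` of `-1` factors `x² + y²` as `(x + iy)(x - iy)`. -/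
def isotropicEquiv (h2 : (2 : K) ≠ 0) {i : K} (hi : i * i = -1) : K × K ≃ K × K where
  toFun z := (z.1 + i * z.2, z.1 - i * z.2)
  invFun w := ((w.1 + w.2) / 2, -i * (w.1 - w.2) / 2)
  left_inv z := by
    ext
    · simp [← two_mul, h2]
    · simp only
      field_simp
      linear_combination (-2 * z.2) * hi
  right_inv w := by
    ext
    · simp only
      field_simp
      linear_combination (-(w.1 - w.2)) * hi
    · simp only
      field_simp
      linear_combination (w.1 - w.2) * hi

end TracePairing

/-- for `p` odd prime, `s = 2`, `s1 = s2 = 1`, the code `C_D` over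
`F_p` with codewords `(Tr_{F_{p²}/F_p}(ax+by)+c)_{(x,y)∈D}`,
`D = {(x,y) ∈ F_{p²}² : Tr(x²+y²)=0}`, is a `[p³+p²-p, 5]` code over `F_p` whose
minimum Hamming distance equals `p²(p-1)`. -/
theorem stmt14 (p : ℕ) (hp : p.Prime) (hodd : Odd p)
    (K : Type) [Field K] [Fintype K] [DecidableEq K] [CharP K p]
    (hcard : Fintype.card K = p ^ 2) :
    let D : Finset (K × K) := Finset.univ.filter
      (fun xy : K × K => Algebra.trace (ZMod p) K (xy.1 ^ 2 + xy.2 ^ 2) = 0)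
    let wt : K → K → ZMod p → ℕ := fun a b c =>
      (D.filter (fun xy => Algebra.trace (ZMod p) K (a * xy.1 + b * xy.2) + c ≠ 0)).card
    -- length is p³ + p² - p
    (D.card = p ^ 3 + p ^ 2 - p) ∧
    -- dimension is 5: the parametrizing map is injective and its domain has F_p-dimension 5
    Function.Injective (fun t : K × K × ZMod p =>
      (fun xy : {z : K × K // z ∈ D} =>
        Algebra.trace (ZMod p) K (t.1 * xy.val.1 + t.2.1 * xy.val.2) + t.2.2)) ∧
    Module.finrank (ZMod p) (K × K × ZMod p) = 5 ∧
    -- minimum distance is p²(p-1)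
    (∀ a b : K, ∀ c : ZMod p, ¬(a = 0 ∧ b = 0 ∧ c = 0) →
      p ^ 2 * (p - 1) ≤ wt a b c) ∧
    (∃ a : K, ∃ b : K, ∃ c : ZMod p, ¬(a = 0 ∧ b = 0 ∧ c = 0) ∧
      wt a b c = p ^ 2 * (p - 1)) := by
  intro D wt
  have : Fact p.Prime := ⟨hp⟩
  have h2 : (2 : K) ≠ 0 := Ring.two_ne_zero fun h => by
    have := (ringChar.eq K p).symm.trans h
    subst this
    exact absurd hodd (by decide)
  obtain ⟨i, hi⟩ : IsSquare (-1 : K) := by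
    rw [FiniteField.isSquare_neg_one_iff, hcard]
    obtain ⟨k, rfl⟩ := hodd
    have : (2 * k + 1) ^ 2 = 4 * (k ^ 2 + k) + 1 := by ring
    omega
  replace hi : i * i = -1 := hi.symm
  let T := Algebra.trace (ZMod p) K
  have hT : Function.Surjective T := Algebra.trace_surjective (ZMod p) K
  have hD : D.card = p ^ 3 + p ^ 2 - p := by
    rw [← card_isotropic hT hcard]
    refine Finset.card_equiv (isotropicEquiv h2 hi) fun z => ?_
    have : (z.1 + i * z.2) * (z.1 - i * z.2) = z.1 ^ 2 + z.2 ^ 2 := by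
      linear_combination (-z.2 ^ 2) * hi
    simp only [D, T, isotropicEquiv, Finset.mem_filter, Finset.mem_univ, true_and,
      Equiv.coe_fn_mk, this]
  have hwt (a b : K) (c : ZMod p) : wt (a + b) (i * (a - b)) c = isotropicWeight T a b c := by
    refine Finset.card_equiv (isotropicEquiv h2 hi) fun z => ?_
    have h1 : (z.1 + i * z.2) * (z.1 - i * z.2) = z.1 ^ 2 + z.2 ^ 2 := by
      linear_combination (-z.2 ^ 2) * hi
    have h3 : a * (z.1 + i * z.2) + b * (z.1 - i * z.2) =
        (a + b) * z.1 + i * (a - b) * z.2 := by ring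
    simp only [D, T, isotropicEquiv, Finset.mem_filter, Finset.mem_univ, true_and, Equiv.coe_fn_mk,
      h1, h3]
  have hmin (a b : K) (c : ZMod p) (h : ¬(a = 0 ∧ b = 0 ∧ c = 0)) :
      p ^ 2 * (p - 1) ≤ wt a b c := by
    have ha : (a - i * b) / 2 + (a + i * b) / 2 = a := by field_simp; ring
    have hb : i * ((a - i * b) / 2 - (a + i * b) / 2) = b := by
      field_simp
      linear_combination (-2 * b) * hi
    have hw := hwt ((a - i * b) / 2) ((a + i * b) / 2) c
    rw [ha, hb] at hw
    rw [hw]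
    refine le_isotropicWeight hT hcard fun ⟨h1, h3, hc⟩ => h ⟨?_, ?_, hc⟩
    · rw [← ha, h1, h3, add_zero]
    · rw [← hb, h1, h3, sub_zero, mul_zero]
  refine ⟨hD, ?_, ?_, hmin, ?_⟩
  · rintro ⟨a, b, c⟩ ⟨a', b', c'⟩ h
    by_contra hne
    have hpos : 0 < wt (a - a') (b - b') (c - c') := by
      refine lt_of_lt_of_le ?_ (hmin _ _ _ fun ⟨h1, h3, h4⟩ => hne ?_)
      · exact Nat.mul_pos (pow_pos hp.pos 2) (Nat.sub_pos_of_lt hp.one_lt)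
      · rw [sub_eq_zero.1 h1, sub_eq_zero.1 h3, sub_eq_zero.1 h4]
    obtain ⟨z, hz⟩ := Finset.card_pos.1 hpos
    obtain ⟨hzD, hz0⟩ := Finset.mem_filter.1 hz
    have hval := congrFun h ⟨z, hzD⟩
    apply hz0
    simp only [map_add] at hval
    simp only [sub_mul, map_add, map_sub]
    linear_combination hval
  · have hK : Module.finrank (ZMod p) K = 2 := by
      have := Module.card_eq_pow_finrank (K := ZMod p) (V := K)
      rw [hcard, ZMod.card] at this
      exact (Nat.pow_right_injective hp.two_le this).symm
    rw [Module.finrank_prod, Module.finrank_prod, hK, Module.finrank_self]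
  · refine ⟨0 + 1, i * (0 - 1), 0, by simp, ?_⟩
    rw [hwt]
    exact isotropicWeight_zero_one hT hcard
end
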